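/- arXiv:1308.6007 — 7 statements merged into one kernel-verified Lean document; each statement's English description precedes it below -/
import Mathlib

section
/- Let n ≥ 1 and n' ≥ 1 be integers, let δ > 0, and let κ ≥ 5 be an integer with cos(2π/κ) > 1 − δ. Suppose that for every nonzero m ∈ ℤ/2^n one has Re((1/n')·Σ_{k=0}^{n'−1} e(3^k·m/2^n)) ≤ 1 − δ, where 3^k·m is computed in ℤ/2^n. Then for all distinct m, m' ∈ ℤ/2^n, the Hamming distance between the tuples (γ(e(3^k·m/2^n)))_{k=0}^{n'−1} and (γ(e(3^k·m'/2^n)))_{k=0}^{n'−1} is at least η·n', where η = (cos(2π/κ) − (1−δ)) / (1 + cos(2π/κ)) > 0. In other words, the bound of Conjecture 1 for all nonzero frequencies implies that the map m ↦ (γ(e(3^k·m/2^n)))_{k<n'} is a code over Σ = {0,...,κ−1} with relative minimum distance at least η. -/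
/-- The rounding map `γ`: sends a complex number `z` with `|z| = 1` to the unique
`ℓ ∈ {0, …, κ-1}` such that `-π/κ ≤ arg (z · e(-ℓ/κ)) < π/κ`. -/
noncomputable def gamma (κ : ℕ) (z : ℂ) : ℕ :=
  ((⌊z.arg * κ / (2 * Real.pi) + 1 / 2⌋) % (κ : ℤ)).toNat

/-- For `w ∈ ℤ/N`, `e_N(w) = exp(2πi·w̃/N)` for any integer representative `w̃` of `w`. -/
noncomputable def eN (N : ℕ) (w : ZMod N) : ℂ :=
  Complex.exp (2 * Real.pi * Complex.I * (w.val : ℝ) / (N : ℝ))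

theorem eN_eq_toCircle (N : ℕ) [NeZero N] (w : ZMod N) : eN N w = (ZMod.toCircle w : ℂ) := by
  rw [ZMod.toCircle_apply, eN]
  push_cast
  rfl

/-- Unit complex numbers with the same rounding are at angular distance at most `2π/κ`. -/
theorem cos_le_re_div_of_gamma_eq {κ : ℕ} (hκ : 5 ≤ κ) (z w : Circle)
    (h : gamma κ z = gamma κ w) :
    Real.cos (2 * Real.pi / κ) ≤ ((z / w : Circle) : ℂ).re := by
  have hκ5 : (5 : ℝ) ≤ κ := by exact_mod_cast hκ
  have hκ0 : (0 : ℝ) < κ := by linarith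
  have hπ := Real.pi_pos
  obtain ⟨c, hc⟩ : (κ : ℤ) ∣ ⌊(z : ℂ).arg * κ / (2 * Real.pi) + 1 / 2⌋ -
      ⌊(w : ℂ).arg * κ / (2 * Real.pi) + 1 / 2⌋ := by
    have hκz : (κ : ℤ) ≠ 0 := by omega
    have h₁ := Int.emod_nonneg ⌊(z : ℂ).arg * κ / (2 * Real.pi) + 1 / 2⌋ hκz
    have h₂ := Int.emod_nonneg ⌊(w : ℂ).arg * κ / (2 * Real.pi) + 1 / 2⌋ hκz
    unfold gamma at h
    exact Int.ModEq.dvd (show _ % _ = _ % _ by omega)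
  have hcr : (⌊(z : ℂ).arg * κ / (2 * Real.pi) + 1 / 2⌋ : ℝ) -
      ⌊(w : ℂ).arg * κ / (2 * Real.pi) + 1 / 2⌋ = κ * c := by exact_mod_cast hc
  have key : |(z : ℂ).arg - (w : ℂ).arg - c * (2 * Real.pi)| ≤ 2 * Real.pi / κ := by
    have e : (z : ℂ).arg - (w : ℂ).arg - c * (2 * Real.pi) =
        ((z : ℂ).arg * κ / (2 * Real.pi) - (w : ℂ).arg * κ / (2 * Real.pi) - κ * c) *
          (2 * Real.pi / κ) := by
      field_simp
    rw [e, abs_mul, abs_of_pos (show 0 < 2 * Real.pi / κ by positivity)]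
    refine mul_le_of_le_one_left (by positivity) (abs_le.mpr ?_)
    have a₁ := Int.floor_le ((z : ℂ).arg * κ / (2 * Real.pi) + 1 / 2)
    have a₂ := Int.lt_floor_add_one ((z : ℂ).arg * κ / (2 * Real.pi) + 1 / 2)
    have b₁ := Int.floor_le ((w : ℂ).arg * κ / (2 * Real.pi) + 1 / 2)
    have b₂ := Int.lt_floor_add_one ((w : ℂ).arg * κ / (2 * Real.pi) + 1 / 2)
    constructor <;> linarith
  have hre : ((z / w : Circle) : ℂ).re =
      Real.cos |(z : ℂ).arg - (w : ℂ).arg - c * (2 * Real.pi)| := by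
    rw [Real.cos_abs, Real.cos_sub_int_mul_two_pi]
    conv_lhs => rw [← Circle.exp_arg z, ← Circle.exp_arg w, ← Circle.exp_sub, Circle.coe_exp,
      Complex.exp_ofReal_mul_I_re]
  rw [hre]
  refine Real.cos_le_cos_of_nonneg_of_le_pi (abs_nonneg _) ?_ key
  rw [div_le_iff₀ hκ0]
  nlinarith

theorem neg_one_le_re_coe_circle (z : Circle) : -1 ≤ (z : ℂ).re := by
  have h := Complex.abs_re_le_norm (z : ℂ)
  rw [Circle.norm_coe] at h
  exact (abs_le.mp h).1

/-- A sum of terms bounded below by `c` off the places where `x` and `y` differ, and by `-1`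
there, is bounded below in terms of the Hamming distance. -/
theorem mul_sub_hammingDist_le_sum {ι β : Type*} [Fintype ι] [DecidableEq β] (x y : ι → β)
    (f : ι → ℝ) (c : ℝ) (hne : ∀ i, -1 ≤ f i) (heq : ∀ i, x i = y i → c ≤ f i) :
    c * Fintype.card ι - (1 + c) * hammingDist x y ≤ ∑ i, f i := by
  calc c * Fintype.card ι - (1 + c) * hammingDist x y
      = ∑ i, (c - if x i ≠ y i then 1 + c else 0) := by
        rw [Finset.sum_sub_distrib, ← Finset.sum_filter, Finset.sum_const, Finset.sum_const,
          nsmul_eq_mul, nsmul_eq_mul, hammingDist, Finset.card_univ]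
        ring
    _ ≤ ∑ i, f i := by
        refine Finset.sum_le_sum fun i _ => ?_
        split_ifs with hi
        · linarith [hne i]
        · simpa using heq i (not_not.mp hi)

/-- If the exponential-sum bound of Conjecture 1 holds at every nonzero frequency
`m ∈ ℤ/2^n`, then `m ↦ (γ(e(3^k·m/2^n)))_{k < n'}` is a code over `{0,…,κ-1}` with
relative minimum distance at least `η = (cos(2π/κ) - (1-δ)) / (1 + cos(2π/κ)) > 0`. -/
theorem block_code_of_exponential_sum_bound (n n' κ : ℕ) (hn : 1 ≤ n) (hn' : 1 ≤ n')
    (δ : ℝ) (hδ : 0 < δ) (hκ : 5 ≤ κ)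
    (hcos : 1 - δ < Real.cos (2 * Real.pi / κ))
    (H : ∀ m : ZMod (2 ^ n), m ≠ 0 →
      ((1 / (n' : ℂ)) *
        ∑ k ∈ Finset.range n', eN (2 ^ n) ((3 : ZMod (2 ^ n)) ^ k * m)).re ≤ 1 - δ) :
    0 < (Real.cos (2 * Real.pi / κ) - (1 - δ)) / (1 + Real.cos (2 * Real.pi / κ)) ∧
    ∀ m m' : ZMod (2 ^ n), m ≠ m' →
      ((Real.cos (2 * Real.pi / κ) - (1 - δ)) / (1 + Real.cos (2 * Real.pi / κ))) * (n' : ℝ) ≤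
      (hammingDist
        (fun k : Fin n' => gamma κ (eN (2 ^ n) ((3 : ZMod (2 ^ n)) ^ (k : ℕ) * m)))
        (fun k : Fin n' => gamma κ (eN (2 ^ n) ((3 : ZMod (2 ^ n)) ^ (k : ℕ) * m'))) : ℝ) := by
  have hκ5 : (5 : ℝ) ≤ κ := by exact_mod_cast hκ
  have hπ := Real.pi_pos
  have hc : 0 < Real.cos (2 * Real.pi / κ) := by
    refine Real.cos_pos_of_mem_Ioo ⟨by linarith [show 0 < 2 * Real.pi / κ by positivity], ?_⟩
    rw [div_lt_iff₀ (by linarith)]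
    nlinarith
  refine ⟨div_pos (by linarith) (by linarith), fun m m' hmm => ?_⟩
  have hn'0 : (0 : ℝ) < n' := by exact_mod_cast hn'
  have hsum := H (m - m') (sub_ne_zero.mpr hmm)
  rw [show (1 / (n' : ℂ)) = ((1 / (n' : ℝ) : ℝ) : ℂ) by push_cast; rfl, Complex.re_ofReal_mul,
    one_div_mul_eq_div, div_le_iff₀ hn'0, Complex.re_sum, Finset.sum_range] at hsum
  have hlow := mul_sub_hammingDist_le_sum
    (fun k : Fin n' => gamma κ (eN (2 ^ n) ((3 : ZMod (2 ^ n)) ^ (k : ℕ) * m)))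
    (fun k : Fin n' => gamma κ (eN (2 ^ n) ((3 : ZMod (2 ^ n)) ^ (k : ℕ) * m')))
    (fun k : Fin n' => (eN (2 ^ n) ((3 : ZMod (2 ^ n)) ^ (k : ℕ) * (m - m'))).re)
    (Real.cos (2 * Real.pi / κ))
    (fun k => by
      rw [eN_eq_toCircle]
      exact neg_one_le_re_coe_circle _)
    (fun k hk => by
      simp only [eN_eq_toCircle] at hk ⊢
      rw [mul_sub, AddChar.map_sub_eq_div]
      exact cos_le_re_div_of_gamma_eq hκ _ _ hk)
  rw [Fintype.card_fin] at hlow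
  rw [div_mul_eq_mul_div, div_le_iff₀ (by linarith)]
  linarith
end

section
/- Suppose there exists δ > 0 such that for every ℓ ≥ 1 and every sequence y_1,...,y_ℓ with y_1 = 1 and y_j ∈ {−1,0,1}, Re( (1/ℓ)·Σ_{i=1}^{ℓ} e( (1/2)·Σ_{j=1}^{i} (3/2)^{i−j}·y_j ) ) ≤ 1 − δ. Let κ ≥ 5 be an integer with cos(2π/κ) > 1 − δ, and let α = γ ∘ β. Then for every n ≥ 1 and all distinct x, x' ∈ {0,1}^n, d_Σ(α*(x), α*(x')) ≥ c'·d_T(x,x'), where c' = (cos(2π/κ) − (1−δ)) / (1 + cos(2π/κ)) > 0. That is, under this hypothesis α satisfies the tree code distance property with constant c'. -/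
/-- `e(x) = exp(2πix)`. -/
noncomputable def e (x : ℝ) : ℂ := Complex.exp (2 * Real.pi * Complex.I * x)

/-- The argument (in `[0,1)`, as a multiple of `2π`) of `β(x₁,…,x_k)`:
`β(ε) = 1 = e(0)`, and `β(x₁,…,x_k) = e((3/2)·b + x_k/2)` where `b ∈ [0,1)` is such that
`β(x₁,…,x_{k-1}) = e(b)`.  The list records the string `x₁,…,x_k` in order. -/
noncomputable def betaArg (l : List ℕ) : ℝ :=
  l.foldl (fun b xk => Int.fract ((3 / 2) * b + (xk : ℝ) / 2)) 0

/-- `β(x₁,…,x_k)` for the binary string recorded by the list `l`. -/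
noncomputable def beta (l : List ℕ) : ℂ := e (betaArg l)

theorem e_re (t : ℝ) : (e t).re = Real.cos (2 * Real.pi * t) := by
  rw [e, ← Complex.exp_ofReal_mul_I_re]
  congr 2
  push_cast
  ring

theorem e_im (t : ℝ) : (e t).im = Real.sin (2 * Real.pi * t) := by
  rw [e, ← Complex.exp_ofReal_mul_I_im]
  congr 2
  push_cast
  ring

theorem norm_e (t : ℝ) : ‖e t‖ = 1 := by
  rw [e, ← Complex.norm_exp_ofReal_mul_I (2 * Real.pi * t)]
  congr 2
  push_cast
  ring

theorem cos_arg_e (t : ℝ) : Real.cos (e t).arg = Real.cos (2 * Real.pi * t) := by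
  rw [Complex.cos_arg (norm_ne_zero_iff.mp (by simp [norm_e])), norm_e, div_one, e_re]

theorem sin_arg_e (t : ℝ) : Real.sin (e t).arg = Real.sin (2 * Real.pi * t) := by
  rw [Complex.sin_arg, norm_e, div_one, e_im]

theorem cos_arg_e_sub_arg_e (s t : ℝ) :
    Real.cos ((e s).arg - (e t).arg) = Real.cos (2 * Real.pi * (s - t)) := by
  rw [Real.cos_sub, mul_sub, Real.cos_sub, cos_arg_e, cos_arg_e, sin_arg_e, sin_arg_e]

/-- Points rounded to the same letter are at angular distance less than `2π/κ`. -/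
theorem cos_lt_cos_arg_sub_arg_of_gamma_eq {κ : ℕ} (hκ : 2 ≤ κ) {z w : ℂ}
    (h : gamma κ z = gamma κ w) :
    Real.cos (2 * Real.pi / κ) < Real.cos (z.arg - w.arg) := by
  have hκ0 : (0 : ℝ) < κ := by positivity
  have hκ2 : (2 : ℝ) ≤ κ := by exact_mod_cast hκ
  unfold gamma at h
  set u := z.arg * κ / (2 * Real.pi) + 1 / 2 with hu
  set v := w.arg * κ / (2 * Real.pi) + 1 / 2 with hv
  have hκZ : (κ : ℤ) ≠ 0 := by lia
  have hmod : ⌊u⌋ % (κ : ℤ) = ⌊v⌋ % (κ : ℤ) := by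
    have h1 := Int.emod_nonneg ⌊u⌋ hκZ
    have h2 := Int.emod_nonneg ⌊v⌋ hκZ
    lia
  obtain ⟨t, ht⟩ := Int.ModEq.dvd hmod.symm
  have htR : (⌊u⌋ : ℝ) - ⌊v⌋ = κ * t := by exact_mod_cast ht
  have hz : z.arg - w.arg - t * (2 * Real.pi) = (u - v - κ * t) * (2 * Real.pi / κ) := by
    rw [hu, hv]
    field_simp
    ring
  have habs : |u - v - κ * t| < 1 := by
    rw [abs_lt]
    constructor <;>
      linarith [Int.floor_le u, Int.lt_floor_add_one u, Int.floor_le v, Int.lt_floor_add_one v]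
  have hpos : 0 < 2 * Real.pi / κ := by positivity
  rw [← Real.cos_sub_int_mul_two_pi (z.arg - w.arg) t, hz, ← Real.cos_abs (_ * _), abs_mul,
    abs_of_pos hpos]
  refine Real.cos_lt_cos_of_nonneg_of_le_pi (by positivity) ?_ ?_
  · rw [div_le_iff₀ hκ0]
    nlinarith [Real.pi_pos]
  · nlinarith

theorem betaArg_append_singleton (l : List ℕ) (a : ℕ) :
    betaArg (l ++ [a]) = Int.fract ((3 / 2) * betaArg l + (a : ℝ) / 2) := by
  simp [betaArg, List.flatMap_append]

theorem betaArg_take_succ {n : ℕ} (x : Fin n → ℕ) {k : ℕ} (hk : k < n) :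
    betaArg ((List.ofFn x).take (k + 1)) =
      Int.fract ((3 / 2) * betaArg ((List.ofFn x).take k) + (x ⟨k, hk⟩ : ℝ) / 2) := by
  have hk' : k < (List.ofFn x).length := by simpa using hk
  rw [← List.take_concat_get' _ _ hk', betaArg_append_singleton, List.getElem_ofFn]

theorem betaArg_take_congr {n : ℕ} (x x' : Fin n → ℕ) {k : ℕ}
    (h : ∀ i : Fin n, (i : ℕ) < k → x i = x' i) :
    betaArg ((List.ofFn x).take k) = betaArg ((List.ofFn x').take k) := by
  congr 1
  apply List.ext_getElem
  · simp
  · intro i h1 h2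
    simp only [List.length_take, List.length_ofFn, lt_inf_iff] at h1
    simpa using h ⟨i, h1.2⟩ h1.1

/-- The integer by which the expansion with digits in `{0, 1}` built from `M` exceeds
the sequence with increments `M k / 2`. -/
def digitCarry (M : ℕ → ℤ) : ℕ → ℤ
  | 0 => 0
  | k + 1 => (3 * digitCarry M k - M k + (3 * digitCarry M k - M k) % 2) / 2

theorem half_sum_Icc_succ (y : ℕ → ℝ) (i : ℕ) :
    (1 / 2) * ∑ j ∈ Finset.Icc 1 (i + 1), (3 / 2 : ℝ) ^ (i + 1 - j) * y j =
      3 / 2 * ((1 / 2) * ∑ j ∈ Finset.Icc 1 i, (3 / 2 : ℝ) ^ (i - j) * y j) + y (i + 1) / 2 := by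
  rw [Finset.sum_Icc_succ_top (by lia), Nat.sub_self, pow_zero, one_mul]
  have : ∑ j ∈ Finset.Icc 1 i, (3 / 2 : ℝ) ^ (i + 1 - j) * y j =
      3 / 2 * ∑ j ∈ Finset.Icc 1 i, (3 / 2 : ℝ) ^ (i - j) * y j := by
    rw [Finset.mul_sum]
    refine Finset.sum_congr rfl fun j hj => ?_
    rw [Nat.succ_sub (Finset.mem_Icc.mp hj).2, pow_succ]
    ring
  rw [this]
  ring

/-- A sequence starting at `0` with `D (k + 1) = (3/2) D k + M k / 2` for integers `M k`, `M 0`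
odd, agrees modulo `1` with a base `3/2` expansion with digits in `{0, 1}` and first digit `1`. -/
theorem exists_digits {ℓ : ℕ} (D : ℕ → ℝ) (M : ℕ → ℤ) (h0 : D 0 = 0) (hodd : M 0 % 2 = 1)
    (hD : ∀ k < ℓ, D (k + 1) = 3 / 2 * D k + M k / 2) :
    ∃ y : ℕ → ℝ, y 1 = 1 ∧ (∀ j, y j = 0 ∨ y j = 1) ∧ ∀ i ≤ ℓ, ∃ p : ℤ,
      (1 / 2) * ∑ j ∈ Finset.Icc 1 i, (3 / 2 : ℝ) ^ (i - j) * y j = D i + p := by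
  refine ⟨fun j => (((3 * digitCarry M (j - 1) - M (j - 1)) % 2 : ℤ) : ℝ), ?_, fun j => ?_,
    fun i hi => ⟨digitCarry M i, ?_⟩⟩
  · have : (3 * digitCarry M 0 - M 0) % 2 = 1 := by
      rw [digitCarry]
      lia
    simp [this]
  · dsimp only
    exact_mod_cast Int.emod_two_eq_zero_or_one (3 * digitCarry M (j - 1) - M (j - 1))
  · induction i with
    | zero => simp [h0, digitCarry]
    | succ i ih =>
      rw [half_sum_Icc_succ, ih (by lia), hD i (by lia), Nat.add_sub_cancel]
      have h2 : 2 * digitCarry M (i + 1) =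
          3 * digitCarry M i - M i + (3 * digitCarry M i - M i) % 2 := by
        rw [digitCarry]
        lia
      have h2R : (2 : ℝ) * digitCarry M (i + 1) =
          3 * digitCarry M i - M i + ((3 * digitCarry M i - M i) % 2 : ℤ) := by
        exact_mod_cast h2
      linarith

/-- If the average of `f` is at most `a`, and `f ≥ -1` is at least `c` where `p` fails,
then `p` has density at least `(c - a) / (1 + c)`. -/
theorem mul_card_le_card_filter {ι : Type*} (t : Finset ι) (p : ι → Prop) [DecidablePred p]
    (f : ι → ℝ) {a c : ℝ} (hsum : ∑ i ∈ t, f i ≤ t.card * a) (hf : ∀ i ∈ t, -1 ≤ f i)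
    (hc : ∀ i ∈ t, ¬ p i → c ≤ f i) :
    (c - a) * t.card ≤ (1 + c) * (t.filter p).card := by
  have h : ∑ i ∈ t, (c - (1 + c) * if p i then 1 else 0) ≤ ∑ i ∈ t, f i := by
    refine Finset.sum_le_sum fun i hi => ?_
    split_ifs with hp
    · linarith [hf i hi]
    · linarith [hc i hi hp]
  rw [Finset.sum_sub_distrib, ← Finset.mul_sum, Finset.sum_boole, Finset.sum_const,
    nsmul_eq_mul] at h
  linarith

/-- If Conjecture 2 holds with constant `δ > 0` and `κ ≥ 5` satisfies `cos(2π/κ) > 1-δ`,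
then `α = γ ∘ β` satisfies the tree code distance property with constant
`c' = (cos(2π/κ) - (1-δ)) / (1 + cos(2π/κ)) > 0`: for distinct `x, x' ∈ {0,1}ⁿ` whose
first disagreement is at (0-indexed) position `ℓ₀` (so `d_T(x,x') = n - ℓ₀`), the Hamming
distance between `α*(x)` and `α*(x')` is at least `c'·(n - ℓ₀)`. -/
theorem tree_code_distance_of_conjecture (δ : ℝ) (hδ : 0 < δ)
    (H : ∀ ℓ : ℕ, 1 ≤ ℓ → ∀ y : ℕ → ℝ, y 1 = 1 →
      (∀ j, 1 ≤ j → j ≤ ℓ → (y j = -1 ∨ y j = 0 ∨ y j = 1)) →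
      ((1 / (ℓ : ℂ)) * ∑ i ∈ Finset.Icc 1 ℓ,
        e ((1 / 2) * ∑ j ∈ Finset.Icc 1 i, (3 / 2 : ℝ) ^ (i - j) * y j)).re ≤ 1 - δ)
    (κ : ℕ) (hκ : 5 ≤ κ) (hcos : 1 - δ < Real.cos (2 * Real.pi / κ))
    (n : ℕ) (hn : 1 ≤ n) (x x' : Fin n → ℕ)
    (hx : ∀ i, x i = 0 ∨ x i = 1) (hx' : ∀ i, x' i = 0 ∨ x' i = 1)
    (ℓ₀ : ℕ) (hℓ₀ : ℓ₀ < n) (hdiff : x ⟨ℓ₀, hℓ₀⟩ ≠ x' ⟨ℓ₀, hℓ₀⟩)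
    (hpre : ∀ i : Fin n, (i : ℕ) < ℓ₀ → x i = x' i) :
    0 < (Real.cos (2 * Real.pi / κ) - (1 - δ)) / (1 + Real.cos (2 * Real.pi / κ)) ∧
    ((Real.cos (2 * Real.pi / κ) - (1 - δ)) / (1 + Real.cos (2 * Real.pi / κ))) *
        ((n : ℝ) - (ℓ₀ : ℝ)) ≤
      (hammingDist
        (fun k : Fin n => gamma κ (beta ((List.ofFn x).take ((k : ℕ) + 1))))
        (fun k : Fin n => gamma κ (beta ((List.ofFn x').take ((k : ℕ) + 1)))) : ℝ) := by
  have hκ0 : (0 : ℝ) < κ := by positivity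
  have hcpos : 0 < 1 + Real.cos (2 * Real.pi / κ) := by
    have : 0 < Real.cos (2 * Real.pi / κ) := by
      have hκ5 : (5 : ℝ) ≤ κ := by exact_mod_cast hκ
      refine Real.cos_pos_of_mem_Ioo ⟨?_, ?_⟩
      · have : 0 < 2 * Real.pi / κ := by positivity
        linarith [Real.pi_pos]
      · rw [div_lt_iff₀ hκ0]
        nlinarith [Real.pi_pos]
    linarith
  refine ⟨div_pos (by linarith) hcpos, ?_⟩
  set B : ℕ → ℝ := fun k => betaArg ((List.ofFn x).take k) with hB
  set B' : ℕ → ℝ := fun k => betaArg ((List.ofFn x').take k) with hB'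
  have hstep : ∀ k, ∃ M : ℤ, (k = 0 → M % 2 = 1) ∧ (k < n - ℓ₀ →
      B (ℓ₀ + (k + 1)) - B' (ℓ₀ + (k + 1)) = 3 / 2 * (B (ℓ₀ + k) - B' (ℓ₀ + k)) + M / 2) := by
    intro k
    by_cases hk : k < n - ℓ₀
    · have hk' : ℓ₀ + k < n := by lia
      refine ⟨(x ⟨ℓ₀ + k, hk'⟩ : ℤ) - x' ⟨ℓ₀ + k, hk'⟩ -
        2 * (⌊3 / 2 * B (ℓ₀ + k) + (x ⟨ℓ₀ + k, hk'⟩ : ℝ) / 2⌋ -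
          ⌊3 / 2 * B' (ℓ₀ + k) + (x' ⟨ℓ₀ + k, hk'⟩ : ℝ) / 2⌋), ?_, fun _ => ?_⟩
      · rintro rfl
        have h1 := hx ⟨ℓ₀, hℓ₀⟩
        have h2 := hx' ⟨ℓ₀, hℓ₀⟩
        simp only [Nat.add_zero]
        lia
      · simp only [hB, hB', ← add_assoc]
        rw [betaArg_take_succ x hk', betaArg_take_succ x' hk', Int.fract, Int.fract]
        push_cast
        ring
    · exact ⟨1, fun _ => rfl, fun h => absurd h hk⟩
  choose M hodd hM using hstep
  obtain ⟨y, hy1, hy, hyD⟩ := exists_digits (ℓ := n - ℓ₀) (fun k => B (ℓ₀ + k) - B' (ℓ₀ + k)) M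
    (sub_eq_zero.mpr (betaArg_take_congr x x' hpre)) (hodd 0 rfl) hM
  have hlen : ((n - ℓ₀ : ℕ) : ℝ) = n - ℓ₀ := Nat.cast_sub hℓ₀.le
  have hlen0 : (0 : ℝ) < (n - ℓ₀ : ℕ) := by
    rw [hlen, sub_pos]
    exact_mod_cast hℓ₀
  have hH := H (n - ℓ₀) (by lia) y hy1 fun j _ _ => .inr (hy j)
  rw [one_div, ← Complex.ofReal_natCast, ← Complex.ofReal_inv, Complex.re_ofReal_mul,
    inv_mul_le_iff₀ hlen0, Complex.re_sum] at hH
  have hre : ∀ i ∈ Finset.Icc 1 (n - ℓ₀),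
      (e ((1 / 2) * ∑ j ∈ Finset.Icc 1 i, (3 / 2 : ℝ) ^ (i - j) * y j)).re =
        Real.cos (2 * Real.pi * (B (ℓ₀ + i) - B' (ℓ₀ + i))) := by
    intro i hi
    obtain ⟨p, hp⟩ := hyD i (Finset.mem_Icc.mp hi).2
    rw [e_re, hp, mul_add, mul_comm _ (p : ℝ), Real.cos_add_int_mul_two_pi]
  rw [Finset.sum_congr rfl hre] at hH
  have hcount := mul_card_le_card_filter (Finset.Icc 1 (n - ℓ₀))
    (fun i => gamma κ (e (B (ℓ₀ + i))) ≠ gamma κ (e (B' (ℓ₀ + i)))) _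
    (c := Real.cos (2 * Real.pi / κ)) (by simpa using hH) (fun _ _ => Real.neg_one_le_cos _)
    fun i _ hi => by
      rw [← cos_arg_e_sub_arg_e]
      exact (cos_lt_cos_arg_sub_arg_of_gamma_eq (by lia) (not_not.mp hi)).le
  rw [Nat.card_Icc, Nat.add_sub_cancel, hlen] at hcount
  rw [div_mul_eq_mul_div, div_le_iff₀ hcpos, mul_comm (hammingDist _ _ : ℝ)]
  refine hcount.trans (mul_le_mul_of_nonneg_left (Nat.cast_le.mpr ?_) hcpos.le)
  refine Finset.card_le_card_of_surjOn (fun k : Fin n => (k : ℕ) + 1 - ℓ₀) fun i hi => ?_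
  rw [Finset.mem_coe, Finset.mem_filter, Finset.mem_Icc] at hi
  obtain ⟨⟨hi1, hin⟩, hne⟩ := hi
  refine ⟨⟨ℓ₀ + i - 1, by lia⟩, ?_, ?_⟩
  · have : ℓ₀ + i - 1 + 1 = ℓ₀ + i := by lia
    rw [Finset.mem_coe, Finset.mem_filter]
    simpa only [beta, this, hB, hB', Finset.mem_univ, true_and] using hne
  · show ℓ₀ + i - 1 + 1 - ℓ₀ = i
    lia
end

section
/- Let ℓ ≥ 1, let y_1,...,y_ℓ be a sequence with y_1 = 1 and y_j ∈ {−1,0,1}, and set z = Σ_{j=1}^{ℓ} 2^{j−1}·3^{ℓ−j}·y_j ∈ ℤ. Then for every 1 ≤ i ≤ ℓ, e( (1/2)·Σ_{j=1}^{i} (3/2)^{i−j}·y_j ) = e_{2^ℓ}( (2·3^{−1})^{ℓ−i}·z ), where 3^{−1} denotes the multiplicative inverse of 3 in ℤ/2^ℓ and z is taken modulo 2^ℓ. Consequently, (1/ℓ)·Σ_{i=1}^{ℓ} e( (1/2)·Σ_{j=1}^{i} (3/2)^{i−j}·y_j ) = (1/ℓ)·Σ_{m=0}^{ℓ−1} e_{2^ℓ}(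 (2·3^{−1})^{m}·z ). -/
theorem eN_intCast (N : ℕ) [NeZero N] (k : ℤ) : eN N (k : ZMod N) = e ((k : ℝ) / N) := by
  have hN : (N : ℂ) ≠ 0 := Nat.cast_ne_zero.mpr (NeZero.ne N)
  have hval : (((k : ZMod N).val : ℕ) : ℂ) = (k : ℂ) - N * ((k / N : ℤ) : ℂ) := by
    have h : (((k : ZMod N).val : ℕ) : ℤ) = k - N * (k / N) := by
      rw [ZMod.val_intCast, Int.emod_def]
    exact_mod_cast congrArg (Int.cast : ℤ → ℂ) h
  unfold eN e
  rw [Complex.exp_eq_exp_iff_exists_int]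
  refine ⟨-(k / N), ?_⟩
  push_cast
  rw [hval]
  field_simp
  ring

/-- The integer `Σ_{j=1}^n 2^{j-1}·3^{n-j}·y_j`. -/
def weightedSum (y : ℕ → ℤ) (n : ℕ) : ℤ :=
  ∑ j ∈ Finset.Icc 1 n, 2 ^ (j - 1) * 3 ^ (n - j) * y j

theorem weightedSum_succ (y : ℕ → ℤ) (n : ℕ) :
    weightedSum y (n + 1) = 3 * weightedSum y n + 2 ^ n * y (n + 1) := by
  unfold weightedSum
  rw [Finset.sum_Icc_succ_top (by omega), Finset.mul_sum]
  congr 1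
  · refine Finset.sum_congr rfl fun j hj => ?_
    rw [Nat.succ_sub (Finset.mem_Icc.mp hj).2, pow_succ]
    ring
  · simp

theorem two_pow_dvd_weightedSum_sub (y : ℕ → ℤ) (i m : ℕ) :
    (2 : ℤ) ^ i ∣ weightedSum y (i + m) - 3 ^ m * weightedSum y i := by
  induction m with
  | zero => simp
  | succ m ih =>
    obtain ⟨c, hc⟩ := ih
    refine ⟨3 * c + 2 ^ m * y (i + m + 1), ?_⟩
    rw [← add_assoc, weightedSum_succ, eq_add_of_sub_eq hc]
    ring

theorem half_mul_sum_eq_weightedSum_div (y : ℕ → ℤ) (i : ℕ) :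
    (1 / 2) * ∑ j ∈ Finset.Icc 1 i, (3 / 2 : ℝ) ^ (i - j) * (y j : ℝ) =
      (weightedSum y i : ℝ) / 2 ^ i := by
  unfold weightedSum
  push_cast
  rw [Finset.mul_sum, Finset.sum_div]
  refine Finset.sum_congr rfl fun j hj => ?_
  obtain ⟨hj1, hji⟩ := Finset.mem_Icc.mp hj
  have hpow : (2 : ℝ) ^ i = 2 ^ (i - j) * 2 ^ (j - 1) * 2 := by
    rw [← pow_add, ← pow_succ]
    congr 1
    omega
  rw [hpow, div_pow]
  field_simp

theorem two_mul_inv_three_pow_mul_weightedSum (y : ℕ → ℤ) (i m : ℕ) :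
    (2 * (3 : ZMod (2 ^ (i + m)))⁻¹) ^ m * (weightedSum y (i + m) : ZMod (2 ^ (i + m))) =
      ((2 ^ m * weightedSum y i : ℤ) : ZMod (2 ^ (i + m))) := by
  have h3 : (3 : ZMod (2 ^ (i + m)))⁻¹ * 3 = 1 := by
    have hcop : Nat.Coprime 3 (2 ^ (i + m)) := Nat.Coprime.pow_right _ (by norm_num)
    rw [mul_comm]
    exact_mod_cast ZMod.coe_mul_inv_eq_one 3 hcop
  have h2 : (2 : ZMod (2 ^ (i + m))) ^ m * 2 ^ i = 0 := by
    rw [← pow_add, add_comm m i]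
    exact_mod_cast ZMod.natCast_self (2 ^ (i + m))
  obtain ⟨c, hc⟩ := two_pow_dvd_weightedSum_sub y i m
  have h3m : (3 : ZMod (2 ^ (i + m)))⁻¹ ^ m * 3 ^ m = 1 := by rw [← mul_pow, h3, one_pow]
  rw [eq_add_of_sub_eq hc, mul_pow]
  push_cast
  linear_combination ((3 : ZMod (2 ^ (i + m)))⁻¹ ^ m * c) * h2 + (2 ^ m * (weightedSum y i)) * h3m

/-- For a sequence `y₁,…,y_ℓ` with `y₁ = 1`, `y_j ∈ {-1,0,1}`, and
`z = Σ_{j=1}^ℓ 2^{j-1}·3^{ℓ-j}·y_j ∈ ℤ`, each term of the sum in Conjecture 2 equals the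
corresponding term `e_{2^ℓ}((2·3⁻¹)^{ℓ-i}·z)`, and consequently the two averages agree. -/
theorem conjecture_terms_as_exponential_sum (ℓ : ℕ) (hℓ : 1 ≤ ℓ)
    (y : ℕ → ℤ) (hy1 : y 1 = 1)
    (hy : ∀ j, 1 ≤ j → j ≤ ℓ → (y j = -1 ∨ y j = 0 ∨ y j = 1))
    (z : ℤ) (hz : z = ∑ j ∈ Finset.Icc 1 ℓ, 2 ^ (j - 1) * 3 ^ (ℓ - j) * y j) :
    (∀ i, 1 ≤ i → i ≤ ℓ →
      e ((1 / 2) * ∑ j ∈ Finset.Icc 1 i, (3 / 2 : ℝ) ^ (i - j) * (y j : ℝ)) =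
        eN (2 ^ ℓ) ((2 * (3 : ZMod (2 ^ ℓ))⁻¹) ^ (ℓ - i) * (z : ZMod (2 ^ ℓ)))) ∧
    (1 / (ℓ : ℂ)) * ∑ i ∈ Finset.Icc 1 ℓ,
        e ((1 / 2) * ∑ j ∈ Finset.Icc 1 i, (3 / 2 : ℝ) ^ (i - j) * (y j : ℝ)) =
      (1 / (ℓ : ℂ)) * ∑ m ∈ Finset.range ℓ,
        eN (2 ^ ℓ) ((2 * (3 : ZMod (2 ^ ℓ))⁻¹) ^ m * (z : ZMod (2 ^ ℓ))) := by
  have hterm : ∀ i, 1 ≤ i → i ≤ ℓ →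
      e ((1 / 2) * ∑ j ∈ Finset.Icc 1 i, (3 / 2 : ℝ) ^ (i - j) * (y j : ℝ)) =
        eN (2 ^ ℓ) ((2 * (3 : ZMod (2 ^ ℓ))⁻¹) ^ (ℓ - i) * (z : ZMod (2 ^ ℓ))) := by
    intro i _ hi
    obtain ⟨m, rfl⟩ := Nat.exists_eq_add_of_le hi
    have hz' : z = weightedSum y (i + m) := hz
    rw [hz', Nat.add_sub_cancel_left, two_mul_inv_three_pow_mul_weightedSum, eN_intCast,
      half_mul_sum_eq_weightedSum_div]
    congr 1
    push_cast
    rw [pow_add]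
    field_simp
  refine ⟨hterm, ?_⟩
  congr 1
  refine Finset.sum_bij' (fun i _ => ℓ - i) (fun m _ => ℓ - m) ?_ ?_ ?_ ?_ ?_
  · intro i hi
    simp only [Finset.mem_Icc, Finset.mem_range] at hi ⊢
    omega
  · intro m hm
    simp only [Finset.mem_Icc, Finset.mem_range] at hm ⊢
    omega
  · intro i hi
    exact Nat.sub_sub_self (Finset.mem_Icc.mp hi).2
  · intro m hm
    exact Nat.sub_sub_self (Finset.mem_range.mp hm).le
  · intro i hi
    exact hterm i (Finset.mem_Icc.mp hi).1 (Finset.mem_Icc.mp hi).2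
end

section
/- Let ℓ ≥ 1. An element z ∈ ℤ/2^ℓ is odd if and only if there exists a sequence y_1,...,y_ℓ with y_1 = 1 and y_j ∈ {−1,0,1} such that z = Σ_{j=1}^{ℓ} 2^{j−1}·3^{ℓ−j}·y_j in ℤ/2^ℓ. -/
/-- Raising the length `n` of the weighted sum `∑ 2^(j-1) 3^(n-j) y j` by one. -/
theorem sum_two_pow_three_pow_succ (n : ℕ) (y : ℕ → ℤ) :
    ∑ j ∈ Finset.Icc 1 (n + 1), 2 ^ (j - 1) * 3 ^ (n + 1 - j) * y j =
      3 * (∑ j ∈ Finset.Icc 1 n, 2 ^ (j - 1) * 3 ^ (n - j) * y j) + 2 ^ n * y (n + 1) := by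
  rw [Finset.sum_Icc_succ_top (by omega), Finset.mul_sum]
  congr 1
  · refine Finset.sum_congr rfl fun j hj => ?_
    rw [Nat.sub_add_comm (Finset.mem_Icc.mp hj).2, pow_succ]
    ring
  · simp

theorem odd_sum_two_pow_three_pow {n : ℕ} (hn : 1 ≤ n) (y : ℕ → ℤ) (hy : y 1 = 1) :
    Odd (∑ j ∈ Finset.Icc 1 n, 2 ^ (j - 1) * 3 ^ (n - j) * y j) := by
  induction n, hn using Nat.le_induction with
  | base => simp [hy]
  | succ n hn ih =>
    rw [sum_two_pow_three_pow_succ]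
    have h2 : Even ((2 : ℤ) ^ n) := even_two.pow_of_ne_zero (by omega)
    exact ((by decide : Odd (3 : ℤ)).mul ih).add_even (h2.mul_right _)

/-- Every odd integer is congruent modulo `2 ^ n` to a weighted sum with digits in `{0, 1}`. -/
theorem exists_two_pow_dvd_sub_sum {n : ℕ} (hn : 1 ≤ n) {a : ℤ} (ha : Odd a) :
    ∃ y : ℕ → ℤ, y 1 = 1 ∧ (∀ j, y j = 0 ∨ y j = 1) ∧
      (2 : ℤ) ^ n ∣ a - ∑ j ∈ Finset.Icc 1 n, 2 ^ (j - 1) * 3 ^ (n - j) * y j := by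
  induction n, hn using Nat.le_induction generalizing a with
  | base =>
    refine ⟨fun _ => 1, rfl, fun _ => Or.inr rfl, ?_⟩
    obtain ⟨k, rfl⟩ := ha
    simp
  | succ n hn ih =>
    obtain ⟨u, v, huv⟩ : IsCoprime (3 : ℤ) (2 ^ (n + 1)) :=
      IsCoprime.pow_right ⟨1, -1, by norm_num⟩
    have hu : Odd u := by
      have h : Odd (u * 3) := by
        rw [eq_sub_of_add_eq huv, pow_succ]
        exact odd_one.sub_even ((even_two.mul_left _).mul_left _)
      exact (Int.odd_mul.mp h).1
    obtain ⟨y, hy1, hy, k, hk⟩ := ih (hu.mul ha)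
    have hsum : ∑ j ∈ Finset.Icc 1 n, 2 ^ (j - 1) * 3 ^ (n - j) *
        Function.update y (n + 1) (k % 2) j =
        ∑ j ∈ Finset.Icc 1 n, 2 ^ (j - 1) * 3 ^ (n - j) * y j := by
      refine Finset.sum_congr rfl fun j hj => ?_
      have := (Finset.mem_Icc.mp hj).2
      rw [Function.update_of_ne (by omega)]
    refine ⟨Function.update y (n + 1) (k % 2), ?_, fun j => ?_, ?_⟩
    · rw [Function.update_of_ne (by omega), hy1]
    · rcases eq_or_ne j (n + 1) with rfl | hj
      · rw [Function.update_self]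
        exact Int.emod_two_eq_zero_or_one k
      · rw [Function.update_of_ne hj]
        exact hy j
    · rw [sum_two_pow_three_pow_succ, hsum, Function.update_self]
      refine ⟨a * v + k + k / 2, ?_⟩
      rw [pow_succ] at huv ⊢
      linear_combination 3 * hk - a * huv - 2 ^ n * Int.emod_add_mul_ediv k 2

theorem ZMod.isUnit_intCast_two_pow_iff_odd {n : ℕ} (hn : 1 ≤ n) (a : ℤ) :
    IsUnit (a : ZMod (2 ^ n)) ↔ Odd a := by
  rw [ZMod.coe_int_isUnit_iff_isCoprime]
  push_cast
  rw [IsCoprime.pow_left_iff (by omega), Int.isCoprime_two_left]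


/-- An element `z ∈ ℤ/2^ℓ` is odd (i.e., a unit) if and only if it can be written as
`Σ_{j=1}^ℓ 2^{j-1}·3^{ℓ-j}·y_j` for some sequence `y₁,…,y_ℓ` with `y₁ = 1` and
`y_j ∈ {-1,0,1}`. -/
theorem odd_iff_representable (ℓ : ℕ) (hℓ : 1 ≤ ℓ) (z : ZMod (2 ^ ℓ)) :
    IsUnit z ↔ ∃ y : ℕ → ℤ, y 1 = 1 ∧
      (∀ j, 1 ≤ j → j ≤ ℓ → (y j = -1 ∨ y j = 0 ∨ y j = 1)) ∧
      z = ((∑ j ∈ Finset.Icc 1 ℓ, 2 ^ (j - 1) * 3 ^ (ℓ - j) * y j : ℤ) : ZMod (2 ^ ℓ)) := by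
  constructor
  · intro hz
    obtain ⟨a, rfl⟩ := ZMod.intCast_surjective z
    obtain ⟨y, hy1, hy, hdvd⟩ :=
      exists_two_pow_dvd_sub_sum hℓ ((ZMod.isUnit_intCast_two_pow_iff_odd hℓ a).mp hz)
    refine ⟨y, hy1, fun j _ _ => Or.inr (hy j), Eq.symm ?_⟩
    rw [ZMod.intCast_eq_intCast_iff_dvd_sub]
    exact_mod_cast hdvd
  · rintro ⟨y, hy1, -, rfl⟩
    exact (ZMod.isUnit_intCast_two_pow_iff_odd hℓ _).mpr (odd_sum_two_pow_three_pow hℓ y hy1)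
end

section
/- For every ℓ ≥ 1, the set of complex numbers { (1/ℓ)·Σ_{i=1}^{ℓ} e( (1/2)·Σ_{j=1}^{i} (3/2)^{i−j}·y_j ) : y_1 = 1, y_j ∈ {−1,0,1} for 2 ≤ j ≤ ℓ } is equal to the set { (1/ℓ)·Σ_{m=0}^{ℓ−1} e_{2^ℓ}( (2·3^{−1})^{m}·z ) : z ∈ ℤ/2^ℓ odd }, where 3^{−1} denotes the multiplicative inverse of 3 in ℤ/2^ℓ. In particular, Conjecture 2 of the paper holds with a given δ > 0 if and only if Conjecture 3 holds with the same δ. -/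
/-- Conjecture 2 with constant `δ`: for all `ℓ ≥ 1` and all `y₁,…,y_ℓ` with `y₁ = 1` and
`y_j ∈ {-1,0,1}`, `Re((1/ℓ)·Σ_{i=1}^ℓ e((1/2)·Σ_{j=1}^i (3/2)^{i-j}·y_j)) ≤ 1-δ`. -/
def Conj2 (δ : ℝ) : Prop :=
  ∀ ℓ : ℕ, 1 ≤ ℓ → ∀ y : ℕ → ℝ, y 1 = 1 →
    (∀ j, 1 ≤ j → j ≤ ℓ → (y j = -1 ∨ y j = 0 ∨ y j = 1)) →
    ((1 / (ℓ : ℂ)) * ∑ i ∈ Finset.Icc 1 ℓ,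
      e ((1 / 2) * ∑ j ∈ Finset.Icc 1 i, (3 / 2 : ℝ) ^ (i - j) * y j)).re ≤ 1 - δ

/-- Conjecture 3 with constant `δ`: for all `ℓ ≥ 1` and all odd `z ∈ ℤ/2^ℓ`,
`Re((1/ℓ)·Σ_{m=0}^{ℓ-1} e_{2^ℓ}((2·3⁻¹)^m·z)) ≤ 1-δ`. -/
def Conj3 (δ : ℝ) : Prop :=
  ∀ ℓ : ℕ, 1 ≤ ℓ → ∀ z : ZMod (2 ^ ℓ), IsUnit z →
    ((1 / (ℓ : ℂ)) * ∑ m ∈ Finset.range ℓ,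
      eN (2 ^ ℓ) ((2 * (3 : ZMod (2 ^ ℓ))⁻¹) ^ m * z)).re ≤ 1 - δ

/-- The integer numerators `X i` of the points `(1/2)·Σ_{j=1}^i (3/2)^{i-j}·y_j = X i / 2^i`. -/
def numerator (y : ℕ → ℤ) : ℕ → ℤ
  | 0 => 0
  | i + 1 => 3 * numerator y i + 2 ^ i * y (i + 1)

theorem half_mul_sum_eq_numerator_div (y : ℕ → ℤ) (i : ℕ) :
    (1 / 2 : ℝ) * ∑ j ∈ Finset.Icc 1 i, (3 / 2 : ℝ) ^ (i - j) * (y j : ℝ) =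
      (numerator y i : ℝ) / 2 ^ i := by
  induction i with
  | zero => simp [numerator]
  | succ i ih =>
    have h : ∑ j ∈ Finset.Icc 1 i, (3 / 2 : ℝ) ^ (i + 1 - j) * (y j : ℝ) =
        3 / 2 * ∑ j ∈ Finset.Icc 1 i, (3 / 2 : ℝ) ^ (i - j) * (y j : ℝ) := by
      rw [Finset.mul_sum]
      refine Finset.sum_congr rfl fun j hj => ?_
      rw [Nat.succ_sub (Finset.mem_Icc.mp hj).2, pow_succ]
      ring
    rw [Finset.sum_Icc_succ_top (by omega), h, Nat.sub_self, pow_zero, one_mul, mul_add,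
      mul_left_comm, ih, numerator]
    push_cast
    field_simp
    ring

theorem odd_numerator (y : ℕ → ℤ) (hy : y 1 = 1) (i : ℕ) : Odd (numerator y (i + 1)) := by
  induction i with
  | zero => simp [numerator, hy]
  | succ i ih =>
    rw [numerator]
    refine Odd.add_even (Odd.mul (by decide) ih) ?_
    rw [pow_succ]
    exact ⟨2 ^ i * y (i + 1 + 1), by ring⟩

theorem numerator_congr {y y' : ℕ → ℤ} {i : ℕ} (h : ∀ j ≤ i, y j = y' j) :
    numerator y i = numerator y' i := by
  induction i with
  | zero => rfl
  | succ i ih =>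
    rw [numerator, numerator, ih fun j hj => h j (by omega), h _ le_rfl]

theorem isUnit_three_zmod_two_pow (l : ℕ) : IsUnit (3 : ZMod (2 ^ l)) := by
  have h : Nat.Coprime 3 (2 ^ l) := Nat.Coprime.pow_right l (by decide)
  exact_mod_cast (ZMod.isUnit_iff_coprime 3 (2 ^ l)).mpr h

theorem isUnit_intCast_zmod_two_pow {k : ℤ} (hk : Odd k) (l : ℕ) :
    IsUnit (k : ZMod (2 ^ l)) := by
  rw [ZMod.coe_int_isUnit_iff_isCoprime]
  push_cast
  exact (Int.isCoprime_two_left.mpr hk).pow_left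

theorem two_mul_inv_three_pow_mul_numerator (y : ℕ → ℤ) (i m : ℕ) :
    (2 * (3 : ZMod (2 ^ (i + m)))⁻¹) ^ m * (numerator y (i + m) : ZMod (2 ^ (i + m))) =
      ((2 ^ m * numerator y i : ℤ) : ZMod (2 ^ (i + m))) := by
  suffices H : ∀ l m i : ℕ, i + m = l →
      (2 * (3 : ZMod (2 ^ l))⁻¹) ^ m * (numerator y l : ZMod (2 ^ l)) =
        ((2 ^ m * numerator y i : ℤ) : ZMod (2 ^ l)) from H _ m i rfl
  intro l m
  induction m with
  | zero => rintro i rfl; simp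
  | succ m ih =>
    intro i hi
    have h3 : (3 : ZMod (2 ^ l)) * 3⁻¹ = 1 :=
      ZMod.mul_inv_of_unit _ (isUnit_three_zmod_two_pow l)
    have h2 : (2 : ZMod (2 ^ l)) ^ (i + m + 1) = 0 := by
      rw [show i + m + 1 = l by omega]
      exact_mod_cast ZMod.natCast_self (2 ^ l)
    rw [pow_succ', mul_assoc, ih (i + 1) (by omega), numerator]
    push_cast
    linear_combination (2 ^ (m + 1) * (numerator y i : ZMod (2 ^ l))) * h3 +
      ((3 : ZMod (2 ^ l))⁻¹ * (y (i + 1) : ZMod (2 ^ l))) * h2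

theorem sum_e_eq_sum_eN (y : ℕ → ℤ) (l : ℕ) :
    ∑ i ∈ Finset.Icc 1 l,
        e ((1 / 2) * ∑ j ∈ Finset.Icc 1 i, (3 / 2 : ℝ) ^ (i - j) * (y j : ℝ)) =
      ∑ m ∈ Finset.range l,
        eN (2 ^ l) ((2 * (3 : ZMod (2 ^ l))⁻¹) ^ m * (numerator y l : ZMod (2 ^ l))) := by
  symm
  refine Finset.sum_bij' (fun m _ => l - m) (fun i _ => l - i) ?_ ?_ ?_ ?_ ?_
  · intro m hm
    simp only [Finset.mem_range, Finset.mem_Icc] at *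
    omega
  · intro i hi
    simp only [Finset.mem_range, Finset.mem_Icc] at *
    omega
  · intro m hm
    simp only [Finset.mem_range] at *
    omega
  · intro i hi
    simp only [Finset.mem_Icc] at *
    omega
  · intro m hm
    obtain ⟨i, rfl⟩ := Nat.exists_eq_add_of_le' (Finset.mem_range.mp hm).le
    rw [two_mul_inv_three_pow_mul_numerator, eN_intCast, Nat.add_sub_cancel,
      half_mul_sum_eq_numerator_div]
    congr 1
    push_cast
    rw [pow_add]
    field_simp

/-- Every odd residue modulo `2 ^ (n + 1)` is the numerator of some digit sequence. -/
theorem exists_digits_numerator_eq (n : ℕ) (z : ℤ) (hz : Odd z) :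
    ∃ y : ℕ → ℤ, y 1 = 1 ∧ (∀ j, y j = 0 ∨ y j = 1) ∧
      (2 : ℤ) ^ (n + 1) ∣ numerator y (n + 1) - z := by
  induction n generalizing z with
  | zero =>
    refine ⟨fun _ => 1, rfl, fun _ => Or.inr rfl, ?_⟩
    obtain ⟨k, rfl⟩ := hz
    exact ⟨-k, by simp [numerator]⟩
  | succ n ih =>
    have hc : IsCoprime (3 : ℤ) (2 ^ (n + 2)) :=
      IsCoprime.pow_right (Int.isCoprime_iff_gcd_eq_one.mpr (by decide))
    obtain ⟨a, b, hab⟩ := hc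
    have ha : Odd a := by
      rw [← Int.not_even_iff_odd]
      rintro ⟨c, rfl⟩
      have : (2 : ℤ) * (3 * c + b * 2 ^ (n + 1)) = 1 := by
        rw [← hab]; ring
      omega
    obtain ⟨y, hy1, hy, k, hk⟩ := ih (a * z) (ha.mul hz)
    have hlow : ∀ d, numerator (Function.update y (n + 2) d) (n + 1) = numerator y (n + 1) :=
      fun d => numerator_congr fun j hj => Function.update_of_ne (by omega) _ _
    refine ⟨Function.update y (n + 2) (k % 2), ?_, fun j => ?_, ?_⟩
    · rw [Function.update_of_ne (by omega), hy1]
    · rcases eq_or_ne j (n + 2) with rfl | hj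
      · rw [Function.update_self]
        omega
      · rw [Function.update_of_ne hj]
        exact hy j
    · rw [numerator, hlow, Function.update_self, Int.emod_def]
      exact ⟨2 * k - k / 2 - b * z, by linear_combination 3 * hk + z * hab⟩

theorem setOf_averages_eq (l : ℕ) (hl : 1 ≤ l) :
    {w : ℂ | ∃ y : ℕ → ℝ, y 1 = 1 ∧
      (∀ j, 2 ≤ j → j ≤ l → (y j = -1 ∨ y j = 0 ∨ y j = 1)) ∧
      w = (1 / (l : ℂ)) * ∑ i ∈ Finset.Icc 1 l,
        e ((1 / 2) * ∑ j ∈ Finset.Icc 1 i, (3 / 2 : ℝ) ^ (i - j) * y j)} =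
    {w : ℂ | ∃ z : ZMod (2 ^ l), IsUnit z ∧
      w = (1 / (l : ℂ)) * ∑ m ∈ Finset.range l,
        eN (2 ^ l) ((2 * (3 : ZMod (2 ^ l))⁻¹) ^ m * z)} := by
  obtain ⟨n, rfl⟩ := Nat.exists_eq_add_of_le' hl
  ext w
  constructor
  · rintro ⟨y, hy1, hy, rfl⟩
    have hint : ∀ j, ∃ d : ℤ, 1 ≤ j → j ≤ n + 1 → y j = d := by
      intro j
      by_cases hj : 1 ≤ j ∧ j ≤ n + 1
      · rcases eq_or_ne j 1 with rfl | hj1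
        · exact ⟨1, fun _ _ => by simp [hy1]⟩
        · rcases hy j (by omega) hj.2 with h | h | h
          · exact ⟨-1, fun _ _ => by simp [h]⟩
          · exact ⟨0, fun _ _ => by simp [h]⟩
          · exact ⟨1, fun _ _ => by simp [h]⟩
      · exact ⟨0, fun h h' => absurd ⟨h, h'⟩ hj⟩
    choose d hd using hint
    have hd1 : d 1 = 1 := by
      have := hd 1 le_rfl hl
      rw [hy1] at this
      exact_mod_cast this.symm
    refine ⟨(numerator d (n + 1) : ZMod (2 ^ (n + 1))),
      isUnit_intCast_zmod_two_pow (odd_numerator d hd1 n) _, ?_⟩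
    rw [← sum_e_eq_sum_eN]
    congr 1
    refine Finset.sum_congr rfl fun i hi => ?_
    congr 2
    refine Finset.sum_congr rfl fun j hj => ?_
    rw [Finset.mem_Icc] at hi hj
    rw [hd j hj.1 (hj.2.trans hi.2)]
  · rintro ⟨z, hz, rfl⟩
    have hodd : Odd (z.val : ℤ) := by
      rw [← ZMod.natCast_zmod_val z, ZMod.isUnit_iff_coprime,
        Nat.coprime_pow_right_iff (Nat.succ_pos n), Nat.coprime_two_right] at hz
      exact_mod_cast hz
    obtain ⟨y, hy1, hy, hdvd⟩ := exists_digits_numerator_eq n z.val hodd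
    have hnum : (numerator y (n + 1) : ZMod (2 ^ (n + 1))) = z := by
      have h : ((numerator y (n + 1) - z.val : ℤ) : ZMod (2 ^ (n + 1))) = 0 := by
        rw [ZMod.intCast_zmod_eq_zero_iff_dvd]
        exact_mod_cast hdvd
      push_cast at h
      rwa [ZMod.natCast_zmod_val, sub_eq_zero] at h
    refine ⟨fun j => y j, by simp [hy1], fun j _ _ => ?_, ?_⟩
    · rcases hy j with h | h <;> simp [h]
    · rw [sum_e_eq_sum_eN, hnum]


/-- For every `ℓ ≥ 1`, the set of averages appearing in Conjecture 2 equals the set of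
averages appearing in Conjecture 3; in particular, Conjecture 2 holds with a given
`δ > 0` if and only if Conjecture 3 holds with the same `δ`. -/
theorem conjecture_two_equiv_conjecture_three :
    (∀ ℓ : ℕ, 1 ≤ ℓ →
      {w : ℂ | ∃ y : ℕ → ℝ, y 1 = 1 ∧
        (∀ j, 2 ≤ j → j ≤ ℓ → (y j = -1 ∨ y j = 0 ∨ y j = 1)) ∧
        w = (1 / (ℓ : ℂ)) * ∑ i ∈ Finset.Icc 1 ℓ,
          e ((1 / 2) * ∑ j ∈ Finset.Icc 1 i, (3 / 2 : ℝ) ^ (i - j) * y j)} =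
      {w : ℂ | ∃ z : ZMod (2 ^ ℓ), IsUnit z ∧
        w = (1 / (ℓ : ℂ)) * ∑ m ∈ Finset.range ℓ,
          eN (2 ^ ℓ) ((2 * (3 : ZMod (2 ^ ℓ))⁻¹) ^ m * z)}) ∧
    (∀ δ : ℝ, 0 < δ → (Conj2 δ ↔ Conj3 δ)) := by
  refine ⟨setOf_averages_eq, fun δ _ => ⟨fun h l hl z hz => ?_, fun h l hl y hy1 hy => ?_⟩⟩
  · obtain ⟨y, hy1, hy, hw⟩ := (setOf_averages_eq l hl).ge ⟨z, hz, rfl⟩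
    rw [hw]
    refine h l hl y hy1 fun j hj hjl => ?_
    rcases eq_or_lt_of_le hj with rfl | hj
    · exact Or.inr (Or.inr hy1)
    · exact hy j hj hjl
  · obtain ⟨z, hz, hw⟩ := (setOf_averages_eq l hl).le
      ⟨y, hy1, fun j hj hjl => hy j (by omega) hjl, rfl⟩
    rw [hw]
    exact h l hl z hz
end

section
/- Let c be a real constant with 0 < c < log 2 / log 3. Then the limit as n → ∞ of (1/⌈cn⌉)·Σ_{k=0}^{⌈cn⌉−1} cos(2π·3^k/2^n) equals 1. In particular, the bound of Conjecture 1 (that this average with m = 1 stays below 1 − δ for a fixed δ > 0) cannot hold for any c < log 2 / log 3. -/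
open Filter Finset in
/-- If `0 ≤ x n k ≤ ε n` for all `k < N n`, with `ε n → 0` and `N n` eventually positive,
then the averages of `cos (x n k)` over `k < N n` tend to `1`. -/
theorem tendsto_average_cos_of_le {N : ℕ → ℕ} {x : ℕ → ℕ → ℝ} {ε : ℕ → ℝ}
    (hN : ∀ᶠ n in atTop, 0 < N n) (hx0 : ∀ n k, 0 ≤ x n k)
    (hx : ∀ n, ∀ k < N n, x n k ≤ ε n) (hε : Tendsto ε atTop (nhds 0)) :
    Tendsto (fun n => (1 / (N n : ℝ)) * ∑ k ∈ range (N n), Real.cos (x n k))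
      atTop (nhds 1) := by
  have hlower : Tendsto (fun n => 1 - ε n ^ 2 / 2) atTop (nhds 1) := by
    simpa using ((hε.pow 2).div_const 2).const_sub 1
  refine tendsto_of_tendsto_of_tendsto_of_le_of_le' hlower tendsto_const_nhds ?_ ?_
  · filter_upwards [hN] with n hn
    have hpos : (0 : ℝ) < N n := by exact_mod_cast hn
    rw [one_div, ← div_eq_inv_mul, le_div_iff₀ hpos, mul_comm]
    simpa using card_nsmul_le_sum (range (N n)) (fun k => Real.cos (x n k)) (1 - ε n ^ 2 / 2)
      fun k hk => by
        have hsq := pow_le_pow_left₀ (hx0 n k) (hx n k (mem_range.mp hk)) 2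
        linarith [Real.one_sub_sq_div_two_le_cos (x := x n k)]
  · filter_upwards [hN] with n hn
    have hpos : (0 : ℝ) < N n := by exact_mod_cast hn
    rw [one_div, ← div_eq_inv_mul, div_le_one₀ hpos]
    simpa using sum_le_card_nsmul (range (N n)) (fun k => Real.cos (x n k)) 1
      fun k _ => Real.cos_le_one _

theorem rpow_lt_of_lt_log_div_log {a b c : ℝ} (ha : 0 < a) (hb : 1 < b)
    (hc : c < Real.log a / Real.log b) : b ^ c < a := by
  rw [lt_div_iff₀ (Real.log_pos hb)] at hc
  exact (Real.rpow_lt_iff_lt_log (by linarith) ha).mpr hc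

/-- For any constant `0 < c < log 2 / log 3`, the average
`(1/⌈cn⌉)·Σ_{k=0}^{⌈cn⌉-1} cos(2π·3^k/2^n)` tends to `1` as `n → ∞`; in particular the
bound of Conjecture 1 cannot hold with any such `c`. -/
theorem average_tends_to_one_of_small_c (c : ℝ) (hc0 : 0 < c)
    (hc : c < Real.log 2 / Real.log 3) :
    Filter.Tendsto
      (fun n : ℕ => (1 / (⌈c * (n : ℝ)⌉₊ : ℝ)) *
        ∑ k ∈ Finset.range ⌈c * (n : ℝ)⌉₊,
          Real.cos (2 * Real.pi * (3 : ℝ) ^ k / (2 : ℝ) ^ n))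
      Filter.atTop (nhds 1) := by
  have hr : (3 : ℝ) ^ c / 2 < 1 := by
    rw [div_lt_one two_pos]
    exact rpow_lt_of_lt_log_div_log two_pos (by norm_num) hc
  refine tendsto_average_cos_of_le (ε := fun n => 2 * Real.pi * ((3 : ℝ) ^ c / 2) ^ n)
    ?_ (fun n k => by positivity) (fun n k hk => ?_) ?_
  · filter_upwards [Filter.eventually_gt_atTop 0] with n hn
    exact Nat.ceil_pos.mpr (by positivity)
  · have hpow : (3 : ℝ) ^ k ≤ ((3 : ℝ) ^ c) ^ n := by
      rw [← Real.rpow_natCast, ← Real.rpow_mul_natCast (by norm_num)]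
      exact Real.rpow_le_rpow_of_exponent_le (by norm_num) (Nat.lt_ceil.mp hk).le
    rw [div_pow, ← mul_div_assoc]
    gcongr
  · simpa using (tendsto_pow_atTop_nhds_zero_of_lt_one (by positivity) hr).const_mul
      (2 * Real.pi)
end

section
/- Let ℓ ≥ 2 and let z be an odd integer with −2^{ℓ−1} < z ≤ 2^{ℓ−1}. Define integers z_0 = z and, for 1 ≤ k ≤ ℓ−1, let z_k be the unique integer with −2^{ℓ−1} < z_k ≤ 2^{ℓ−1} and 3·z_k ≡ 2·z_{k−1} (mod 2^ℓ), and let a_k = (3·z_k − 2·z_{k−1})/2^ℓ ∈ {−2,−1,0,1,2}. Then z_{ℓ−1} = 2^{ℓ−1} and | 1 − Σ_{j=1}^{ℓ−1} (2/3)^{j}·a_{ℓ−j} | ≤ (2/3)^{ℓ−1}. -/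
/-- The solution of the linear recurrence `u (k + 1) = r * (u k + b (k + 1))`. -/
theorem eq_pow_mul_add_sum_of_linear_recurrence {R : Type*} [CommRing R] (r : R) (u b : ℕ → R)
    (n : ℕ) (h : ∀ k < n, u (k + 1) = r * (u k + b (k + 1))) :
    u n = r ^ n * u 0 + ∑ j ∈ Finset.Icc 1 n, r ^ j * b (n + 1 - j) := by
  induction n with
  | zero => simp
  | succ n ih =>
    have hsum : ∑ j ∈ Finset.Icc 1 (n + 1), r ^ j * b (n + 1 + 1 - j) =
        r * b (n + 1) + r * ∑ j ∈ Finset.Icc 1 n, r ^ j * b (n + 1 - j) := by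
      rw [← Finset.add_sum_Ioc_eq_sum_Icc (by omega), Finset.mul_sum, pow_one,
        Nat.add_sub_cancel]
      congr 1
      refine (Finset.sum_bij (fun j _ => j + 1) ?_ ?_ ?_ ?_).symm
      · intro j hj
        simp only [Finset.mem_Icc, Finset.mem_Ioc] at hj ⊢
        omega
      · intro i _ j _ hij
        omega
      · intro j hj
        simp only [Finset.mem_Ioc] at hj
        exact ⟨j - 1, by simp only [Finset.mem_Icc]; omega, by omega⟩
      · intro j _
        rw [Nat.add_sub_add_right, pow_succ]
        ring
    rw [h n n.lt_succ_self, ih fun k hk => h k (by omega), hsum]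
    ring

/-- Multiplying by `2 / 3` modulo `2 ^ l` raises the exact power of two by one, as long as it
stays below `l`. -/
theorem exists_odd_of_two_pow_dvd_three_mul_sub_two_mul {l k : ℕ} (hk : k + 1 < l) {x y : ℤ}
    (hx : ∃ w, Odd w ∧ x = 2 ^ k * w) (hxy : (2 ^ l : ℤ) ∣ 3 * y - 2 * x) :
    ∃ w, Odd w ∧ y = 2 ^ (k + 1) * w := by
  obtain ⟨w, hw, rfl⟩ := hx
  obtain ⟨c, hc⟩ := hxy
  obtain ⟨d, rfl⟩ := Nat.exists_eq_add_of_lt hk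
  have h3 : 3 * y = 2 ^ (k + 1) * (w + 2 * (2 ^ d * c)) := by
    rw [eq_add_of_sub_eq hc]
    ring
  have hdvd : (2 ^ (k + 1) : ℤ) ∣ y :=
    (IsCoprime.pow_left (by norm_num : IsCoprime (2 : ℤ) 3)).dvd_of_dvd_mul_left ⟨_, h3⟩
  obtain ⟨v, rfl⟩ := hdvd
  refine ⟨v, ?_, rfl⟩
  have h3v : 3 * v = w + 2 * (2 ^ d * c) :=
    mul_left_cancel₀ (pow_ne_zero (k + 1) two_ne_zero) (by rw [← h3]; ring)
  obtain ⟨t, rfl⟩ := hw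
  rw [← Int.not_even_iff_odd]
  rintro ⟨s, rfl⟩
  omega


/-- Let `ℓ ≥ 2` and let `z` be an odd integer with `-2^{ℓ-1} < z ≤ 2^{ℓ-1}`.  Let
`z_0 = z` and for `1 ≤ k ≤ ℓ-1` let `z_k` be the integer in `(-2^{ℓ-1}, 2^{ℓ-1}]` with
`3·z_k ≡ 2·z_{k-1} (mod 2^ℓ)`, and set `a_k = (3·z_k - 2·z_{k-1})/2^ℓ`.  Then
`z_{ℓ-1} = 2^{ℓ-1}` and `|1 - Σ_{j=1}^{ℓ-1} (2/3)^j·a_{ℓ-j}| ≤ (2/3)^{ℓ-1}`. -/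
theorem base_three_halves_expansion_of_one (ℓ : ℕ) (hℓ : 2 ≤ ℓ) (z : ℤ) (hodd : Odd z)
    (hz1 : -2 ^ (ℓ - 1) < z) (hz2 : z ≤ 2 ^ (ℓ - 1))
    (zseq aseq : ℕ → ℤ) (hz0 : zseq 0 = z)
    (hzs : ∀ k, 1 ≤ k → k ≤ ℓ - 1 →
      (-2 ^ (ℓ - 1) < zseq k ∧ zseq k ≤ 2 ^ (ℓ - 1) ∧
        (2 ^ ℓ : ℤ) ∣ 3 * zseq k - 2 * zseq (k - 1)))
    (has : ∀ k, 1 ≤ k → k ≤ ℓ - 1 →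
      aseq k = (3 * zseq k - 2 * zseq (k - 1)) / 2 ^ ℓ) :
    zseq (ℓ - 1) = 2 ^ (ℓ - 1) ∧
    |1 - ∑ j ∈ Finset.Icc 1 (ℓ - 1), (2 / 3 : ℝ) ^ j * (aseq (ℓ - j) : ℝ)| ≤
      (2 / 3 : ℝ) ^ (ℓ - 1) := by
  obtain ⟨m, rfl⟩ : ∃ m, ℓ = m + 1 := ⟨ℓ - 1, by omega⟩
  simp only [Nat.add_sub_cancel] at *
  have hval : ∀ k ≤ m, ∃ w, Odd w ∧ zseq k = 2 ^ k * w := by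
    intro k
    induction k with
    | zero => exact fun _ => ⟨z, hodd, by simp [hz0]⟩
    | succ k ih =>
      intro hk
      exact exists_odd_of_two_pow_dvd_three_mul_sub_two_mul (by omega) (ih (by omega))
        (hzs (k + 1) (by omega) hk).2.2
  have hlast : zseq m = 2 ^ m := by
    obtain ⟨w, hw, hzw⟩ := hval m le_rfl
    obtain ⟨hlo, hhi, -⟩ := hzs m (by omega) le_rfl
    have hpos : (0 : ℤ) < 2 ^ m := by positivity
    have hw1 : w ≤ 1 := by
      by_contra! h
      nlinarith
    have hw2 : -1 < w := by
      by_contra! h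
      nlinarith
    obtain ⟨t, rfl⟩ := hw
    obtain rfl : t = 0 := by omega
    simpa using hzw
  refine ⟨hlast, ?_⟩
  have hrec : ∀ k < m, (zseq (k + 1) : ℝ) / 2 ^ m =
      2 / 3 * ((zseq k : ℝ) / 2 ^ m + (aseq (k + 1) : ℝ)) := by
    intro k hk
    have hmul := Int.ediv_mul_cancel (hzs (k + 1) (by omega) hk).2.2
    rw [← has (k + 1) (by omega) hk, Nat.add_sub_cancel] at hmul
    have hreal : (aseq (k + 1) : ℝ) * 2 ^ (m + 1) = 3 * zseq (k + 1) - 2 * zseq k := by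
      exact_mod_cast hmul
    field_simp
    rw [pow_succ] at hreal
    linarith
  have hsol := eq_pow_mul_add_sum_of_linear_recurrence (2 / 3 : ℝ)
    (fun k => (zseq k : ℝ) / 2 ^ m) (fun k => (aseq k : ℝ)) m hrec
  simp only [hlast, hz0] at hsol
  push_cast at hsol
  rw [div_self (by positivity)] at hsol
  rw [sub_eq_of_eq_add hsol, abs_mul, abs_of_nonneg (by positivity : (0 : ℝ) ≤ (2 / 3) ^ m)]
  refine mul_le_of_le_one_right (by positivity) ?_
  rw [abs_div, abs_of_pos (by positivity : (0 : ℝ) < 2 ^ m), div_le_one (by positivity)]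
  exact_mod_cast abs_le.mpr ⟨hz1.le, hz2⟩
end
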